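/- Assume m > 0. The union over all 𝐩 ∈ ℚ_p³ of the spectra of the matrices h(𝐩) (as subsets of ℂ) equals the set {ε·√(m² + c₁ + c₂ + c₃) : ε ∈ {1,−1}, and each cᵢ ∈ {0} ∪ {p^{2k} : k ∈ ℤ}}; in particular every such eigenvalue E is real with |E| ≥ m, so this union is contained in (−∞,−m] ∪ [m,∞). -/

import Mathlib

open Complex Matrix

/-- The three Pauli matrices. -/
noncomputable def pauli : Fin 3 → Matrix (Fin 2) (Fin 2) ℂ :=
  ![!![0, 1; 1, 0], !![0, -I; I, 0], !![1, 0; 0, -1]]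

/-- The Dirac matrix `β = [[1₂,0],[0,−1₂]]`. -/
noncomputable def diracBeta : Matrix (Fin 4) (Fin 4) ℂ :=
  !![1, 0, 0, 0;
     0, 1, 0, 0;
     0, 0, -1, 0;
     0, 0, 0, -1]

/-- The Dirac matrices `α_k = [[0,σ_k],[σ_k,0]]`, k = 1,2,3. -/
noncomputable def diracAlpha : Fin 3 → Matrix (Fin 4) (Fin 4) ℂ :=
  ![!![0, 0, 0, 1;
      0, 0, 1, 0;
      0, 1, 0, 0;
      1, 0, 0, 0],
    !![0, 0, 0, -I;
      0, 0, I, 0;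
      0, -I, 0, 0;
      I, 0, 0, 0],
    !![0, 0, 1, 0;
      0, 0, 0, -1;
      1, 0, 0, 0;
      0, -1, 0, 0]]

/-- The p-adic Dirac symbol `h(𝐩) = Σ_k ‖p_k‖_p α_k + m β`. -/
noncomputable def diracSymbol (p : ℕ) [Fact p.Prime] (m : ℝ) (P : Fin 3 → ℚ_[p]) :
    Matrix (Fin 4) (Fin 4) ℂ :=
  (∑ k : Fin 3, (‖P k‖ : ℂ) • diracAlpha k) + (m : ℂ) • diracBeta

/-- `λ(𝐩) = √(m² + |𝐩|²_p)`, where `|𝐩|²_p = Σ_k ‖p_k‖_p²`. -/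
noncomputable def lam (p : ℕ) [Fact p.Prime] (m : ℝ) (P : Fin 3 → ℚ_[p]) : ℝ :=
  Real.sqrt (m ^ 2 + ∑ k : Fin 3, ‖P k‖ ^ 2)

theorem lam_sq (p : ℕ) [Fact p.Prime] (m : ℝ) (P : Fin 3 → ℚ_[p]) :
    lam p m P ^ 2 = m ^ 2 + ∑ k : Fin 3, ‖P k‖ ^ 2 :=
  Real.sq_sqrt (by positivity)

theorem eval_charpoly_diracSymbol (p : ℕ) [Fact p.Prime] (m : ℝ) (P : Fin 3 → ℚ_[p]) (E : ℂ) :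
    (diracSymbol p m P).charpoly.eval E = (E ^ 2 - (lam p m P : ℂ) ^ 2) ^ 2 := by
  have hI : (I : ℂ) ^ 2 = -1 := I_sq
  have hI4 : (I : ℂ) ^ 4 = 1 := I_pow_four
  rw [← ofReal_pow, lam_sq, eval_charpoly]
  simp [diracSymbol, diracAlpha, diracBeta, det_succ_row_zero, Fin.sum_univ_succ, Fin.succAbove,
    scalar_apply]
  ring_nf
  simp only [hI, hI4]
  ring

theorem mem_spectrum_diracSymbol_iff (p : ℕ) [Fact p.Prime] (m : ℝ) (P : Fin 3 → ℚ_[p]) (E : ℂ) :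
    E ∈ spectrum ℂ (diracSymbol p m P) ↔ E = lam p m P ∨ E = -lam p m P := by
  rw [mem_spectrum_iff_isRoot_charpoly, Polynomial.IsRoot.def, eval_charpoly_diracSymbol,
    sq_eq_zero_iff, sub_eq_zero, sq_eq_sq_iff_eq_or_eq_neg]

theorem Padic.exists_norm_sq_eq_iff (p : ℕ) [Fact p.Prime] (c : ℝ) :
    (∃ x : ℚ_[p], ‖x‖ ^ 2 = c) ↔ c = 0 ∨ ∃ k : ℤ, c = (p : ℝ) ^ (2 * k) := by
  constructor
  · rintro ⟨x, rfl⟩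
    rcases eq_or_ne x 0 with rfl | hx
    · simp
    · refine Or.inr ⟨-x.valuation, ?_⟩
      rw [Padic.norm_eq_zpow_neg_valuation hx, mul_comm, _root_.zpow_mul, zpow_ofNat]
  · rintro (rfl | ⟨k, rfl⟩)
    · exact ⟨0, by simp⟩
    · refine ⟨(p : ℚ_[p]) ^ (-k), ?_⟩
      rw [Padic.norm_p_zpow, neg_neg, mul_comm, _root_.zpow_mul, zpow_ofNat]

theorem le_lam (p : ℕ) [Fact p.Prime] (m : ℝ) (P : Fin 3 → ℚ_[p]) : m ≤ lam p m P :=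
  Real.le_sqrt_of_sq_le (le_add_of_nonneg_right (by positivity))

theorem lam_eq_sqrt (p : ℕ) [Fact p.Prime] (m : ℝ) (P : Fin 3 → ℚ_[p]) :
    lam p m P = Real.sqrt (m ^ 2 + ‖P 0‖ ^ 2 + ‖P 1‖ ^ 2 + ‖P 2‖ ^ 2) := by
  simp [lam, Fin.sum_univ_three, add_assoc]

/-- for `m > 0`, the union over all `𝐩 ∈ ℚ_p³` of the spectra of the
matrices `h(𝐩)` equals `{ε·√(m² + c₁ + c₂ + c₃) : ε = ±1, cᵢ ∈ {0} ∪ {p^{2k} : k ∈ ℤ}}`;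
in particular every such eigenvalue is real of absolute value `≥ m`. -/
theorem padic_dirac_spectrum_union (p : ℕ) [Fact p.Prime] (m : ℝ) (hm : 0 < m) :
    (⋃ P : Fin 3 → ℚ_[p], spectrum ℂ (diracSymbol p m P)) =
        {E : ℂ | ∃ ε : ℝ, (ε = 1 ∨ ε = -1) ∧ ∃ c₁ c₂ c₃ : ℝ,
          (c₁ = 0 ∨ ∃ k : ℤ, c₁ = (p : ℝ) ^ (2 * k)) ∧
          (c₂ = 0 ∨ ∃ k : ℤ, c₂ = (p : ℝ) ^ (2 * k)) ∧
          (c₃ = 0 ∨ ∃ k : ℤ, c₃ = (p : ℝ) ^ (2 * k)) ∧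
          E = ((ε * Real.sqrt (m ^ 2 + c₁ + c₂ + c₃) : ℝ) : ℂ)} ∧
      ∀ E ∈ ⋃ P : Fin 3 → ℚ_[p], spectrum ℂ (diracSymbol p m P),
        ∃ x : ℝ, E = (x : ℂ) ∧ m ≤ |x| := by
  constructor
  · ext E
    simp only [Set.mem_iUnion, mem_spectrum_diracSymbol_iff, Set.mem_ofPred_eq,
      ← Padic.exists_norm_sq_eq_iff]
    constructor
    · rintro ⟨P, h⟩
      rcases h with rfl | rfl
      · exact ⟨1, Or.inl rfl, _, _, _, ⟨P 0, rfl⟩, ⟨P 1, rfl⟩, ⟨P 2, rfl⟩, by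
          rw [one_mul, lam_eq_sqrt]⟩
      · exact ⟨-1, Or.inr rfl, _, _, _, ⟨P 0, rfl⟩, ⟨P 1, rfl⟩, ⟨P 2, rfl⟩, by
          rw [neg_one_mul, ofReal_neg, lam_eq_sqrt]⟩
    · rintro ⟨ε, hε, _, _, _, ⟨x, rfl⟩, ⟨y, rfl⟩, ⟨z, rfl⟩, rfl⟩
      refine ⟨![x, y, z], ?_⟩
      rw [lam_eq_sqrt]
      rcases hε with rfl | rfl <;> simp
  · intro E hE
    simp only [Set.mem_iUnion, mem_spectrum_diracSymbol_iff] at hE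
    obtain ⟨P, rfl | rfl⟩ := hE
    · exact ⟨lam p m P, rfl, (le_lam p m P).trans (le_abs_self _)⟩
    · exact ⟨-lam p m P, (ofReal_neg _).symm, by
        simpa only [abs_neg] using (le_lam p m P).trans (le_abs_self _)⟩
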